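/- arXiv:2002.04115 — 3 statements merged into one kernel-verified Lean document; each statement's English description precedes it below -/
import Mathlib

section
/- Let n ≥ 4, p ≥ 1, let Z_1,…,Z_n and δ be arbitrary vectors in ℝ^p, let k_0 be an integer with 2 ≤ k_0 ≤ n−2, and set X_t = Z_t for 1 ≤ t ≤ k_0 and X_t = Z_t + δ for k_0+1 ≤ t ≤ n. Then for every integer k with 2 ≤ k ≤ k_0, G_n(k) = G_n^Z(k) + (k−1)(n−k_0)(n−k_0−1)‖δ‖²/(n−k) − [2(k−1)(n−k−1)(n−k_0)/(k(n−k))] Σ_{i=1}^{k} δᵀZ_i + [2(k−1)(n−k_0−1)/(n−k)] Σ_{j=k_0+1}^{n} δᵀZ_j + [2(k−1)(n−k_0)/(n−k)] Σ_{j=k+1}^{k_0} δᵀZ_j. -/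
open Finset

/-- The U-statistic objective function `G_n(k)` computed from vectors
`X_1, …, X_n` in `ℝ^p` (indexed by `1, …, n`). -/
noncomputable def Gstat (p n : ℕ) (X : ℕ → Fin p → ℝ) (k : ℕ) : ℝ :=
  (1 / ((k : ℝ) * ((n : ℝ) - (k : ℝ)))) *
    ∑ i1 ∈ Finset.Icc 1 k, ∑ i2 ∈ Finset.Icc 1 k,
      ∑ j1 ∈ Finset.Icc (k + 1) n, ∑ j2 ∈ Finset.Icc (k + 1) n,
        if i1 ≠ i2 ∧ j1 ≠ j2 then
          ∑ l, (X i1 l - X j1 l) * (X i2 l - X j2 l)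
        else 0

lemma sum_offdiag_aux (B : Finset ℕ) (x : ℕ → ℝ) (c d e : ℝ) :
    ∑ i ∈ B, ∑ j ∈ B, (if i ≠ j then c * (x i * x j) - d * (x i + x j) + e else 0)
      = c * ((∑ i ∈ B, x i) ^ 2 - ∑ i ∈ B, x i ^ 2)
        - 2 * d * ((B.card : ℝ) - 1) * (∑ i ∈ B, x i)
        + (B.card : ℝ) * ((B.card : ℝ) - 1) * e := by
  have h : ∀ i ∈ B, ∑ j ∈ B, (if i ≠ j then c * (x i * x j) - d * (x i + x j) + e else 0)
      = (c * (x i * ∑ j ∈ B, x j) - d * (B.card * x i + ∑ j ∈ B, x j) + B.card * e)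
        - (c * x i ^ 2 - 2 * d * x i + e) := by
    intro i hi
    have h1 : ∀ j ∈ B, (if i ≠ j then c * (x i * x j) - d * (x i + x j) + e else 0)
        = (c * (x i * x j) - d * (x i + x j) + e)
          - (if i = j then c * (x i * x j) - d * (x i + x j) + e else 0) := by
      intro j _
      by_cases hij : i = j <;> simp [hij]
    rw [Finset.sum_congr rfl h1, Finset.sum_sub_distrib, Finset.sum_ite_eq, if_pos hi]
    simp only [Finset.sum_add_distrib, Finset.sum_sub_distrib, ← Finset.mul_sum,
      Finset.sum_const, nsmul_eq_mul]
    ring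
  rw [Finset.sum_congr rfl h]
  simp only [Finset.sum_add_distrib, Finset.sum_sub_distrib, ← Finset.mul_sum,
    ← Finset.sum_mul, Finset.sum_const, nsmul_eq_mul]
  ring

lemma quad_aux (A B : Finset ℕ) (x : ℕ → ℝ) :
    ∑ i1 ∈ A, ∑ i2 ∈ A, ∑ j1 ∈ B, ∑ j2 ∈ B,
      (if i1 ≠ i2 ∧ j1 ≠ j2 then (x i1 - x j1) * (x i2 - x j2) else 0)
      = (B.card : ℝ) * ((B.card : ℝ) - 1) * ((∑ i ∈ A, x i) ^ 2 - ∑ i ∈ A, x i ^ 2)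
        - 2 * (((B.card : ℝ) - 1) * ∑ j ∈ B, x j) * ((A.card : ℝ) - 1) * (∑ i ∈ A, x i)
        + (A.card : ℝ) * ((A.card : ℝ) - 1) * ((∑ j ∈ B, x j) ^ 2 - ∑ j ∈ B, x j ^ 2) := by
  rw [← sum_offdiag_aux]
  refine Finset.sum_congr rfl fun i1 _ => Finset.sum_congr rfl fun i2 _ => ?_
  by_cases hi : i1 = i2
  · simp [hi]
  · simp only [ne_eq, hi, not_false_eq_true, true_and, if_true]
    -- shift to a symmetric form
    have hs : ∑ j1 ∈ B, ∑ j2 ∈ B, (if ¬ j1 = j2 then (x i1 - x j1) * (x i2 - x j2) else 0)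
        = ∑ j1 ∈ B, ∑ j2 ∈ B, (if j1 ≠ j2 then 1 * (x j1 * x j2)
            - ((x i1 + x i2) / 2) * (x j1 + x j2) + x i1 * x i2 else 0)
          + ((x i1 - x i2) / 2) * ∑ j1 ∈ B, ∑ j2 ∈ B, (if j1 ≠ j2 then x j1 - x j2 else 0) := by
      rw [Finset.mul_sum, ← Finset.sum_add_distrib]
      refine Finset.sum_congr rfl fun j1 _ => ?_
      rw [Finset.mul_sum, ← Finset.sum_add_distrib]
      refine Finset.sum_congr rfl fun j2 _ => ?_
      by_cases hj : j1 = j2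
      · simp [hj]
      · simp only [ne_eq, hj, not_false_eq_true, if_true]
        ring
    have h0 : ∑ j1 ∈ B, ∑ j2 ∈ B, (if j1 ≠ j2 then x j1 - x j2 else 0) = 0 := by
      have : ∀ j1 ∈ B, ∑ j2 ∈ B, (if j1 ≠ j2 then x j1 - x j2 else 0)
          = ∑ j2 ∈ B, (x j1 - x j2) := by
        intro j1 _
        refine Finset.sum_congr rfl fun j2 _ => ?_
        by_cases hj : j1 = j2 <;> simp [hj]
      rw [Finset.sum_congr rfl this]
      simp only [Finset.sum_sub_distrib, Finset.sum_const, nsmul_eq_mul, ← Finset.mul_sum]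
      ring
    rw [hs, h0, sum_offdiag_aux]
    ring

lemma Gstat_eq_aux (p n : ℕ) (X : ℕ → Fin p → ℝ) (k : ℕ) :
    Gstat p n X k = (1 / ((k : ℝ) * ((n : ℝ) - (k : ℝ)))) *
      ∑ l, ∑ i1 ∈ Finset.Icc 1 k, ∑ i2 ∈ Finset.Icc 1 k,
        ∑ j1 ∈ Finset.Icc (k + 1) n, ∑ j2 ∈ Finset.Icc (k + 1) n,
          if i1 ≠ i2 ∧ j1 ≠ j2 then (X i1 l - X j1 l) * (X i2 l - X j2 l) else 0 := by
  unfold Gstat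
  congr 1
  symm
  rw [Finset.sum_comm]
  refine Finset.sum_congr rfl fun i1 _ => ?_
  rw [Finset.sum_comm]
  refine Finset.sum_congr rfl fun i2 _ => ?_
  rw [Finset.sum_comm]
  refine Finset.sum_congr rfl fun j1 _ => ?_
  rw [Finset.sum_comm]
  refine Finset.sum_congr rfl fun j2 _ => ?_
  split_ifs <;> simp

theorem Gstat_decomposition (n p : ℕ) (hn : 4 ≤ n) (hp : 1 ≤ p)
    (Z : ℕ → Fin p → ℝ) (δ : Fin p → ℝ)
    (k0 : ℕ) (hk0l : 2 ≤ k0) (hk0u : k0 ≤ n - 2)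
    (X : ℕ → Fin p → ℝ)
    (hX : ∀ t, X t = if t ≤ k0 then Z t else Z t + δ)
    (k : ℕ) (hk : 2 ≤ k) (hkk0 : k ≤ k0) :
    Gstat p n X k =
      Gstat p n Z k
      + ((k : ℝ) - 1) * ((n : ℝ) - (k0 : ℝ)) * ((n : ℝ) - (k0 : ℝ) - 1) *
          (∑ l, δ l ^ 2) / ((n : ℝ) - (k : ℝ))
      - (2 * ((k : ℝ) - 1) * ((n : ℝ) - (k : ℝ) - 1) * ((n : ℝ) - (k0 : ℝ)) /
          ((k : ℝ) * ((n : ℝ) - (k : ℝ)))) *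
          ∑ i ∈ Finset.Icc 1 k, ∑ l, δ l * Z i l
      + (2 * ((k : ℝ) - 1) * ((n : ℝ) - (k0 : ℝ) - 1) / ((n : ℝ) - (k : ℝ))) *
          ∑ j ∈ Finset.Icc (k0 + 1) n, ∑ l, δ l * Z j l
      + (2 * ((k : ℝ) - 1) * ((n : ℝ) - (k0 : ℝ)) / ((n : ℝ) - (k : ℝ))) *
          ∑ j ∈ Finset.Icc (k + 1) k0, ∑ l, δ l * Z j l := by
  have hkn : k + 2 ≤ n := by omega
  have hk0n : k0 ≤ n := by omega
  have hkpos : (k : ℝ) ≠ 0 := by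
    have : k ≠ 0 := by omega
    exact_mod_cast this
  have hnk : (n : ℝ) - (k : ℝ) ≠ 0 := by
    have : (k : ℝ) + 2 ≤ n := by exact_mod_cast hkn
    linarith
  have hcA : ((Finset.Icc 1 k).card : ℝ) = k := by simp
  have hcB : ((Finset.Icc (k + 1) n).card : ℝ) = (n : ℝ) - k := by
    rw [Nat.card_Icc, Nat.add_sub_add_right, Nat.cast_sub (by omega)]
  have hcC : ((Finset.Icc (k0 + 1) n).card : ℝ) = (n : ℝ) - k0 := by
    rw [Nat.card_Icc, Nat.add_sub_add_right, Nat.cast_sub (by omega)]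
  have hsplit : ∀ f : ℕ → ℝ, ∑ j ∈ Finset.Icc (k + 1) n, f j
      = ∑ j ∈ Finset.Icc (k + 1) k0, f j + ∑ j ∈ Finset.Icc (k0 + 1) n, f j := by
    intro f
    rw [← Finset.sum_union]
    · congr 1
      ext t
      simp only [Finset.mem_union, Finset.mem_Icc]
      omega
    · rw [Finset.disjoint_left]
      intro t h1 h2
      simp only [Finset.mem_Icc] at h1 h2
      omega
  have hlow : ∀ t, t ≤ k0 → ∀ l, X t l = Z t l := by
    intro t ht l
    rw [hX, if_pos ht]
  have hhigh : ∀ t, k0 + 1 ≤ t → ∀ l, X t l = Z t l + δ l := by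
    intro t ht l
    rw [hX, if_neg (by omega)]
    rfl
  have hA : ∀ (g : ℝ → ℝ) (l : Fin p), ∑ i ∈ Finset.Icc 1 k, g (X i l)
      = ∑ i ∈ Finset.Icc 1 k, g (Z i l) := by
    intro g l
    refine Finset.sum_congr rfl fun i hi => ?_
    rw [hlow i (by have := (Finset.mem_Icc.mp hi).2; omega)]
  have hD : ∀ (g : ℝ → ℝ) (l : Fin p), ∑ i ∈ Finset.Icc (k + 1) k0, g (X i l)
      = ∑ i ∈ Finset.Icc (k + 1) k0, g (Z i l) := by
    intro g l
    refine Finset.sum_congr rfl fun i hi => ?_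
    rw [hlow i (Finset.mem_Icc.mp hi).2]
  have hC1 : ∀ l : Fin p, ∑ i ∈ Finset.Icc (k0 + 1) n, X i l
      = ∑ i ∈ Finset.Icc (k0 + 1) n, Z i l + ((n : ℝ) - k0) * δ l := by
    intro l
    rw [← hcC, ← nsmul_eq_mul, ← Finset.sum_const, ← Finset.sum_add_distrib]
    refine Finset.sum_congr rfl fun i hi => ?_
    rw [hhigh i (Finset.mem_Icc.mp hi).1]
  have hC2 : ∀ l : Fin p, ∑ i ∈ Finset.Icc (k0 + 1) n, X i l ^ 2
      = ∑ i ∈ Finset.Icc (k0 + 1) n, Z i l ^ 2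
        + 2 * δ l * ∑ i ∈ Finset.Icc (k0 + 1) n, Z i l + ((n : ℝ) - k0) * δ l ^ 2 := by
    intro l
    rw [← hcC, ← nsmul_eq_mul, ← Finset.sum_const, Finset.mul_sum, ← Finset.sum_add_distrib,
      ← Finset.sum_add_distrib]
    refine Finset.sum_congr rfl fun i hi => ?_
    rw [hhigh i (Finset.mem_Icc.mp hi).1]
    ring
  have hswap : ∀ S : Finset ℕ, ∑ i ∈ S, ∑ l, δ l * Z i l = ∑ l, δ l * ∑ i ∈ S, Z i l := by
    intro S
    rw [Finset.sum_comm]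
    simp only [Finset.mul_sum]
  rw [Gstat_eq_aux, Gstat_eq_aux, hswap, hswap, hswap]
  have key : ∀ l : Fin p, (∑ i1 ∈ Finset.Icc 1 k, ∑ i2 ∈ Finset.Icc 1 k,
        ∑ j1 ∈ Finset.Icc (k + 1) n, ∑ j2 ∈ Finset.Icc (k + 1) n,
          if i1 ≠ i2 ∧ j1 ≠ j2 then (X i1 l - X j1 l) * (X i2 l - X j2 l) else 0)
      = (∑ i1 ∈ Finset.Icc 1 k, ∑ i2 ∈ Finset.Icc 1 k,
        ∑ j1 ∈ Finset.Icc (k + 1) n, ∑ j2 ∈ Finset.Icc (k + 1) n,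
          if i1 ≠ i2 ∧ j1 ≠ j2 then (Z i1 l - Z j1 l) * (Z i2 l - Z j2 l) else 0)
        + ((k : ℝ) * (k - 1) * ((n : ℝ) - k0) * ((n : ℝ) - k0 - 1)) * δ l ^ 2
        - (2 * ((k : ℝ) - 1) * ((n : ℝ) - k - 1) * ((n : ℝ) - k0))
          * (δ l * ∑ i ∈ Finset.Icc 1 k, Z i l)
        + (2 * (k : ℝ) * (k - 1) * ((n : ℝ) - k0 - 1))
          * (δ l * ∑ i ∈ Finset.Icc (k0 + 1) n, Z i l)
        + (2 * (k : ℝ) * (k - 1) * ((n : ℝ) - k0))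
          * (δ l * ∑ i ∈ Finset.Icc (k + 1) k0, Z i l) := by
    intro l
    rw [quad_aux _ _ (fun t => X t l), quad_aux _ _ (fun t => Z t l), hcA, hcB]
    simp only [hsplit]
    rw [hA (fun y => y) l, hA (fun y => y ^ 2) l, hD (fun y => y) l, hD (fun y => y ^ 2) l,
      hC1, hC2]
    ring
  rw [Finset.sum_congr rfl fun l _ => key l]
  simp only [Finset.sum_add_distrib, Finset.sum_sub_distrib, ← Finset.mul_sum]
  generalize (∑ l, ∑ i1 ∈ Finset.Icc 1 k, ∑ i2 ∈ Finset.Icc 1 k,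
        ∑ j1 ∈ Finset.Icc (k + 1) n, ∑ j2 ∈ Finset.Icc (k + 1) n,
          if i1 ≠ i2 ∧ j1 ≠ j2 then (Z i1 l - Z j1 l) * (Z i2 l - Z j2 l) else 0) = T
  field_simp
end

section
/- Let τ ∈ (0,1) and let Φ denote the cumulative distribution function of the standard normal distribution. Define f : ℝ → ℝ by f(t) = (3/2) τ(1−τ) e^{τ(1−τ)|t|} Φ( −(3/2) √(τ(1−τ)|t|) ) − (1/2) τ(1−τ) Φ( −(1/2) √(τ(1−τ)|t|) ). Then: (i) f(−t) = f(t) for all t ∈ ℝ; (ii) f(0) = τ(1−τ)/2; (iii) f attains its unique maximum at t = 0, i.e., f(t) < f(0) for all t ≠ 0; and (iv) f is unchanged when τ is replaced by 1−τ. -/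
open Real

/-- The standard normal cumulative distribution function
`Φ(x) = (2π)^{-1/2} ∫_{-∞}^{x} e^{-u²/2} du`. -/
noncomputable def stdNormalCDF (x : ℝ) : ℝ :=
  (Real.sqrt (2 * Real.pi))⁻¹ * ∫ u in Set.Iic x, Real.exp (-u ^ 2 / 2)

/-- The density of the limiting distribution `ξ(τ)` (Stryhn, 1996). -/
noncomputable def xiDensity (τ t : ℝ) : ℝ :=
  (3 / 2) * (τ * (1 - τ)) * Real.exp (τ * (1 - τ) * |t|) *
      stdNormalCDF (-(3 / 2) * Real.sqrt (τ * (1 - τ) * |t|))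
    - (1 / 2) * (τ * (1 - τ)) *
      stdNormalCDF (-(1 / 2) * Real.sqrt (τ * (1 - τ) * |t|))

/-- The unnormalised Gaussian integral. -/
noncomputable def gI (x : ℝ) : ℝ := ∫ u in Set.Iic x, Real.exp (-u ^ 2 / 2)

lemma gI_integrable : MeasureTheory.Integrable (fun u : ℝ => Real.exp (-u ^ 2 / 2)) := by
  have h := integrable_exp_neg_mul_sq (b := 1 / 2) (by norm_num)
  refine h.congr (Filter.Eventually.of_forall fun u => ?_)
  simp only
  congr 1
  ring

lemma gI_zero : gI 0 = Real.sqrt (2 * Real.pi) / 2 := by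
  have h := integral_gaussian_Ioi (1 / 2)
  have h2 := integral_comp_neg_Iic (0 : ℝ) (fun u : ℝ => Real.exp (-(1 / 2) * u ^ 2))
  rw [neg_zero, h] at h2
  have e : Real.pi / (1 / 2) = 2 * Real.pi := by ring
  rw [e] at h2
  rw [← h2, gI]
  congr 1
  ext u
  congr 1
  ring

lemma gI_hasDerivAt (x : ℝ) : HasDerivAt gI (Real.exp (-x ^ 2 / 2)) x := by
  have hc : Continuous (fun u : ℝ => Real.exp (-u ^ 2 / 2)) := by fun_prop
  have h1 : HasDerivAt (fun y => ∫ u in (0 : ℝ)..y, Real.exp (-u ^ 2 / 2))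
      (Real.exp (-x ^ 2 / 2)) x :=
    intervalIntegral.integral_hasDerivAt_right (hc.intervalIntegrable _ _)
      hc.stronglyMeasurable.stronglyMeasurableAtFilter hc.continuousAt
  have h2 := h1.add_const (gI 0)
  refine h2.congr_of_eventuallyEq (Filter.Eventually.of_forall fun y => ?_)
  have := intervalIntegral.integral_Iic_sub_Iic (μ := MeasureTheory.volume) (a := (0 : ℝ)) (b := y)
    gI_integrable.integrableOn gI_integrable.integrableOn
  simp only [gI]
  linarith

lemma gI_nonneg (x : ℝ) : 0 ≤ gI x :=
  MeasureTheory.integral_nonneg fun _ => (Real.exp_pos _).le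

lemma gI_strictMono : StrictMono gI := by
  apply strictMono_of_deriv_pos
  intro x
  rw [(gI_hasDerivAt x).deriv]
  exact Real.exp_pos _

lemma gI_pos (x : ℝ) : 0 < gI x :=
  (gI_nonneg (x - 1)).trans_lt (gI_strictMono (by linarith))

lemma mills_le (x : ℝ) : x * gI (-x) ≤ Real.exp (-x ^ 2 / 2) := by
  have hInt : MeasureTheory.Integrable (fun u : ℝ => -u * Real.exp (-u ^ 2 / 2)) := by
    have h := (integrable_mul_exp_neg_mul_sq (b := 1 / 2) (by norm_num)).neg
    refine h.congr (Filter.Eventually.of_forall fun u => ?_)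
    simp only [Pi.neg_apply, neg_mul]
    congr 3
    ring
  have hlim : Filter.Tendsto (fun u : ℝ => Real.exp (-u ^ 2 / 2)) Filter.atBot (nhds 0) := by
    apply Real.tendsto_exp_atBot.comp
    have h : Filter.Tendsto (fun u : ℝ => u ^ 2) Filter.atBot Filter.atTop :=
      (Filter.tendsto_pow_atTop (two_ne_zero)).comp Filter.tendsto_abs_atBot_atTop |>.congr
        (fun u => by simp)
    have h2 := Filter.tendsto_neg_atTop_atBot.comp (h.atTop_div_const (two_pos (α := ℝ)))
    refine h2.congr fun u => ?_
    simp only [Function.comp]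
    ring
  have hd : ∀ u : ℝ, HasDerivAt (fun u : ℝ => Real.exp (-u ^ 2 / 2))
      (-u * Real.exp (-u ^ 2 / 2)) u := by
    intro u
    have h : HasDerivAt (fun u : ℝ => Real.exp (-u ^ 2 / 2)) _ u :=
      ((hasDerivAt_pow 2 u).neg.div_const 2).exp
    refine h.congr_deriv ?_
    simp
    ring
  have key := MeasureTheory.integral_Iic_of_hasDerivAt_of_tendsto' (a := -x)
    (fun u _ => hd u) hInt.integrableOn hlim
  rw [sub_zero, neg_sq] at key
  rw [← key, gI, ← MeasureTheory.integral_const_mul]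
  refine MeasureTheory.setIntegral_mono_on (gI_integrable.const_mul x).integrableOn
    hInt.integrableOn measurableSet_Iic fun u hu => ?_
  have hu' : u ≤ -x := hu
  exact mul_le_mul_of_nonneg_right (by linarith) (Real.exp_pos _).le

lemma exp_sq_hasDerivAt (c x : ℝ) :
    HasDerivAt (fun y : ℝ => Real.exp (c * y ^ 2)) (2 * c * x * Real.exp (c * x ^ 2)) x := by
  have h : HasDerivAt (fun y : ℝ => Real.exp (c * y ^ 2)) _ x :=
    ((hasDerivAt_pow 2 x).const_mul c).exp
  refine h.congr_deriv ?_
  simp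
  ring

lemma gI_lin_hasDerivAt (c x : ℝ) :
    HasDerivAt (fun y : ℝ => gI (c * y)) (c * Real.exp (-(c * x) ^ 2 / 2)) x := by
  have h : HasDerivAt (fun y : ℝ => gI (c * y)) _ x :=
    (gI_hasDerivAt (c * x)).comp x ((hasDerivAt_id x).const_mul c)
  refine h.congr_deriv ?_
  ring

lemma mills_lt (x : ℝ) : x * gI (-x) < Real.exp (-x ^ 2 / 2) := by
  have hanti : StrictAnti (fun y : ℝ => Real.exp (-(1 / 2) * y ^ 2) - y * gI (-1 * y)) := by
    apply strictAnti_of_deriv_neg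
    intro y
    have h := (exp_sq_hasDerivAt (-(1 / 2)) y).sub
      ((hasDerivAt_id y).mul (gI_lin_hasDerivAt (-1) y))
    have h' : HasDerivAt (fun y : ℝ => Real.exp (-(1 / 2) * y ^ 2) - y * gI (-1 * y))
      (-gI (-1 * y)) y := by
      refine HasDerivAt.congr_deriv h ?_
      have e : -(-1 * y) ^ 2 / 2 = -(1 / 2) * y ^ 2 := by ring
      rw [e]
      simp only [id]
      ring
    rw [h'.deriv]
    linarith [gI_pos (-1 * y)]
  have h1 := hanti (show x < x + 1 by linarith)
  have h2 := mills_le (x + 1)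
  have e1 : -(1 / 2) * x ^ 2 = -x ^ 2 / 2 := by ring
  have e2 : -(1 / 2) * (x + 1) ^ 2 = -(x + 1) ^ 2 / 2 := by ring
  simp only [neg_one_mul, e1, e2] at h1
  linarith

lemma main_anti : StrictAnti (fun s : ℝ =>
    3 * (Real.exp (1 * s ^ 2) * gI (-(3 / 2) * s)) - gI (-(1 / 2) * s)) := by
  apply strictAnti_of_deriv_neg
  intro s
  have h := (((exp_sq_hasDerivAt 1 s).mul (gI_lin_hasDerivAt (-(3 / 2)) s)).const_mul 3).sub
    (gI_lin_hasDerivAt (-(1 / 2)) s)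
  have e := h.deriv
  have hm := mills_lt (3 / 2 * s)
  have e1 : Real.exp (1 * s ^ 2) * Real.exp (-(3 / 2 * s) ^ 2 / 2)
      = Real.exp (-(1 / 2 * s) ^ 2 / 2) := by
    rw [← Real.exp_add]; congr 1; ring
  have hm2 := mul_lt_mul_of_pos_left hm (Real.exp_pos (1 * s ^ 2))
  rw [e1] at hm2
  refine lt_of_eq_of_lt e ?_
  have e2 : -(-(3 / 2) * s) ^ 2 / 2 = -(3 / 2 * s) ^ 2 / 2 := by ring
  have e3 : -(-(1 / 2) * s) ^ 2 / 2 = -(1 / 2 * s) ^ 2 / 2 := by ring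
  have e4 : -(3 / 2) * s = -(3 / 2 * s) := by ring
  rw [e2, e3, e4]
  linear_combination 4 * hm2 - (9 / 2) * e1

theorem xiDensity_properties (τ : ℝ) (hτ0 : 0 < τ) (hτ1 : τ < 1) :
    (∀ t : ℝ, xiDensity τ (-t) = xiDensity τ t) ∧
    (xiDensity τ 0 = τ * (1 - τ) / 2) ∧
    (∀ t : ℝ, t ≠ 0 → xiDensity τ t < xiDensity τ 0) ∧
    (∀ t : ℝ, xiDensity (1 - τ) t = xiDensity τ t) := by
  have ha : 0 < τ * (1 - τ) := mul_pos hτ0 (by linarith)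
  have hpi : 0 < Real.sqrt (2 * Real.pi) := Real.sqrt_pos.2 (by positivity)
  have hform : ∀ t, xiDensity τ t = (τ * (1 - τ) / 2 * (Real.sqrt (2 * Real.pi))⁻¹) *
      (3 * (Real.exp (1 * Real.sqrt (τ * (1 - τ) * |t|) ^ 2) *
        gI (-(3 / 2) * Real.sqrt (τ * (1 - τ) * |t|)))
        - gI (-(1 / 2) * Real.sqrt (τ * (1 - τ) * |t|))) := by
    intro t
    rw [one_mul, Real.sq_sqrt (by positivity)]
    simp only [xiDensity, stdNormalCDF, gI]
    ring
  refine ⟨fun t => by simp [xiDensity], ?_, ?_, ?_⟩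
  · rw [hform]
    simp only [abs_zero, mul_zero, Real.sqrt_zero, gI_zero]
    field_simp
    norm_num
  · intro t ht
    rw [hform t, hform 0]
    apply mul_lt_mul_of_pos_left _ (by positivity)
    apply main_anti
    have : 0 < |t| := abs_pos.2 ht
    simp only [abs_zero, mul_zero, Real.sqrt_zero]
    exact Real.sqrt_pos.2 (mul_pos ha this)
  · intro t
    have : (1 - τ) * (1 - (1 - τ)) = τ * (1 - τ) := by ring
    simp only [xiDensity, this]
end

section
/- Let n ≥ 2, p ≥ 1, let Z_1,…,Z_n and δ be arbitrary vectors in ℝ^p, let k_0 be an integer with 1 ≤ k_0 ≤ n−1, and set X_t = Z_t for 1 ≤ t ≤ k_0 and X_t = Z_t + δ for k_0+1 ≤ t ≤ n. For 1 ≤ k ≤ n−1 define SSR(k) = Σ_{i=1}^{k} ‖X_i − X̄_{1:k}‖² + Σ_{i=k+1}^{n} ‖X_i − X̄_{(k+1):n}‖², where X̄_{a:b} = (b−a+1)^{−1} Σ_{i=a}^{b} X_i. Then for every integer k with 1 ≤ k ≤ k_0 ≤ n−1, SSR(k) − SSR(k_0) = [(k−k_0)/(k k_0)] Σ_{i=1}^{k}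 Z_iᵀZ_i + [(n−k−k_0)/(k_0(n−k))] Σ_{i=k+1}^{k_0} Z_iᵀZ_i + [(k_0−k)/((n−k_0)(n−k))] Σ_{i=k_0+1}^{n} Z_iᵀZ_i + [(n−k_0)(k_0−k)/(n−k)] ‖δ‖² + [2(k_0−k)/(n−k)] Σ_{i=k_0+1}^{n} δᵀZ_i − [2(n−k_0)/(n−k)] Σ_{i=k+1}^{k_0} δᵀZ_i − (1/k) Σ_{i,j=1, i≠j}^{k} Z_iᵀZ_j − (1/(n−k)) Σ_{i,j=k+1, i≠j}^{n} Z_iᵀZ_j + (1/k_0) Σ_{i,j=1, i≠j}^{k_0} Z_iᵀZ_j + (1/(n−k_0)) Σ_{i,j=k_0+1, i≠j}^{n} Z_iᵀZ_j. -/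
open Finset

/-- The sample mean `X̄_{a:b}` of the vectors `X_a, …, X_b` in `ℝ^p`. -/
noncomputable def sampleMean (p : ℕ) (X : ℕ → Fin p → ℝ) (a b : ℕ) : Fin p → ℝ :=
  fun l => (∑ i ∈ Finset.Icc a b, X i l) / ((b - a + 1 : ℕ) : ℝ)

/-- The least-squares objective `SSR(k)` of Bai (2010). -/
noncomputable def SSR (p n : ℕ) (X : ℕ → Fin p → ℝ) (k : ℕ) : ℝ :=
  ∑ i ∈ Finset.Icc 1 k, ∑ l, (X i l - sampleMean p X 1 k l) ^ 2
    + ∑ i ∈ Finset.Icc (k + 1) n, ∑ l, (X i l - sampleMean p X (k + 1) n l) ^ 2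

theorem ssr_piece (p : ℕ) (X : ℕ → Fin p → ℝ) (a b : ℕ) (m : ℝ) (hab : a ≤ b)
    (hm : m = (b : ℝ) - a + 1) :
    ∑ i ∈ Finset.Icc a b, ∑ l, (X i l - sampleMean p X a b l) ^ 2
      = ∑ l, (∑ i ∈ Finset.Icc a b, X i l * X i l - (∑ i ∈ Finset.Icc a b, X i l) ^ 2 / m) := by
  have hc : ((b - a + 1 : ℕ) : ℝ) = m := by
    rw [hm]; push_cast [Nat.cast_sub hab]; ring
  have hcard : ((Finset.Icc a b).card : ℝ) = m := by
    rw [← hc, Nat.card_Icc]; congr 1; omega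
  have hm0 : m ≠ 0 := by
    rw [← hc]; positivity
  rw [Finset.sum_comm]
  refine Finset.sum_congr rfl fun l _ => ?_
  unfold sampleMean
  rw [hc]
  generalize hS : ∑ i ∈ Finset.Icc a b, X i l = S
  have h : ∀ i ∈ Finset.Icc a b, (X i l - S / m) ^ 2
      = X i l * X i l - (2 * S / m) * X i l + (S / m) ^ 2 := fun i _ => by ring
  rw [Finset.sum_congr rfl h, Finset.sum_add_distrib, Finset.sum_sub_distrib, ← Finset.mul_sum,
    hS, Finset.sum_const, nsmul_eq_mul, hcard]
  field_simp
  ring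

theorem offdiag (p : ℕ) (Z : ℕ → Fin p → ℝ) (s : Finset ℕ) :
    (∑ i ∈ s, ∑ j ∈ s, if i ≠ j then ∑ l, Z i l * Z j l else 0)
      = ∑ l, ((∑ i ∈ s, Z i l) ^ 2 - ∑ i ∈ s, Z i l * Z i l) := by
  have h : ∀ i ∈ s, (∑ j ∈ s, if i ≠ j then ∑ l, Z i l * Z j l else 0)
      = (∑ l, ∑ j ∈ s, Z i l * Z j l) - ∑ l, Z i l * Z i l := by
    intro i hi
    have h2 : ∀ j ∈ s, (if i ≠ j then ∑ l, Z i l * Z j l else 0)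
        = (∑ l, Z i l * Z j l) - if i = j then ∑ l, Z i l * Z j l else 0 := by
      intro j _
      by_cases e : i = j <;> simp [e]
    rw [Finset.sum_congr rfl h2, Finset.sum_sub_distrib, Finset.sum_ite_eq, if_pos hi,
      Finset.sum_comm]
  rw [Finset.sum_congr rfl h, Finset.sum_sub_distrib, Finset.sum_sub_distrib]
  congr 1
  · rw [Finset.sum_comm]
    refine Finset.sum_congr rfl fun l _ => ?_
    rw [sq, Finset.sum_mul_sum]
  · rw [Finset.sum_comm]

theorem icc_split (f : ℕ → ℝ) (a b c : ℕ) (h1 : a ≤ b + 1) (h2 : b ≤ c) :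
    ∑ i ∈ Finset.Icc a c, f i
      = ∑ i ∈ Finset.Icc a b, f i + ∑ i ∈ Finset.Icc (b + 1) c, f i := by
  rw [← Finset.sum_union]
  · congr 1
    ext i
    simp only [Finset.mem_union, Finset.mem_Icc]
    omega
  · rw [Finset.disjoint_left]
    intro i
    simp only [Finset.mem_Icc]
    omega

theorem SSR_difference_decomposition (n p : ℕ) (hn : 2 ≤ n) (hp : 1 ≤ p)
    (Z : ℕ → Fin p → ℝ) (δ : Fin p → ℝ)
    (k0 : ℕ) (hk0l : 1 ≤ k0) (hk0u : k0 ≤ n - 1)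
    (X : ℕ → Fin p → ℝ)
    (hX : ∀ t, X t = if t ≤ k0 then Z t else Z t + δ)
    (k : ℕ) (hk : 1 ≤ k) (hkk0 : k ≤ k0) :
    SSR p n X k - SSR p n X k0 =
      (((k : ℝ) - (k0 : ℝ)) / ((k : ℝ) * (k0 : ℝ))) *
        ∑ i ∈ Finset.Icc 1 k, ∑ l, Z i l * Z i l
      + (((n : ℝ) - (k : ℝ) - (k0 : ℝ)) / ((k0 : ℝ) * ((n : ℝ) - (k : ℝ)))) *
        ∑ i ∈ Finset.Icc (k + 1) k0, ∑ l, Z i l * Z i l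
      + (((k0 : ℝ) - (k : ℝ)) / (((n : ℝ) - (k0 : ℝ)) * ((n : ℝ) - (k : ℝ)))) *
        ∑ i ∈ Finset.Icc (k0 + 1) n, ∑ l, Z i l * Z i l
      + (((n : ℝ) - (k0 : ℝ)) * ((k0 : ℝ) - (k : ℝ)) / ((n : ℝ) - (k : ℝ))) *
        (∑ l, δ l ^ 2)
      + (2 * ((k0 : ℝ) - (k : ℝ)) / ((n : ℝ) - (k : ℝ))) *
        ∑ i ∈ Finset.Icc (k0 + 1) n, ∑ l, δ l * Z i l
      - (2 * ((n : ℝ) - (k0 : ℝ)) / ((n : ℝ) - (k : ℝ))) *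
        ∑ i ∈ Finset.Icc (k + 1) k0, ∑ l, δ l * Z i l
      - (1 / (k : ℝ)) *
        (∑ i ∈ Finset.Icc 1 k, ∑ j ∈ Finset.Icc 1 k,
          if i ≠ j then ∑ l, Z i l * Z j l else 0)
      - (1 / ((n : ℝ) - (k : ℝ))) *
        (∑ i ∈ Finset.Icc (k + 1) n, ∑ j ∈ Finset.Icc (k + 1) n,
          if i ≠ j then ∑ l, Z i l * Z j l else 0)
      + (1 / (k0 : ℝ)) *
        (∑ i ∈ Finset.Icc 1 k0, ∑ j ∈ Finset.Icc 1 k0,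
          if i ≠ j then ∑ l, Z i l * Z j l else 0)
      + (1 / ((n : ℝ) - (k0 : ℝ))) *
        (∑ i ∈ Finset.Icc (k0 + 1) n, ∑ j ∈ Finset.Icc (k0 + 1) n,
          if i ≠ j then ∑ l, Z i l * Z j l else 0) := by
  have hkn : k0 + 1 ≤ n := by omega
  have hkR : (k : ℝ) ≠ 0 := by positivity
  have hk0R : (k0 : ℝ) ≠ 0 := by positivity
  have hnk0 : (n : ℝ) - k0 ≠ 0 := by
    have : (k0 : ℝ) + 1 ≤ n := by exact_mod_cast hkn
    intro h; linarith
  have hnk : (n : ℝ) - k ≠ 0 := by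
    have : (k0 : ℝ) + 1 ≤ n := by exact_mod_cast hkn
    have : (k : ℝ) ≤ k0 := by exact_mod_cast hkk0
    intro h; linarith
  unfold SSR
  rw [ssr_piece p X 1 k k hk (by push_cast; ring),
    ssr_piece p X (k + 1) n ((n : ℝ) - k) (by omega) (by push_cast; ring),
    ssr_piece p X 1 k0 k0 hk0l (by push_cast; ring),
    ssr_piece p X (k0 + 1) n ((n : ℝ) - k0) (by omega) (by push_cast; ring)]
  simp only [offdiag]
  rw [Finset.sum_comm (s := Finset.Icc 1 k), Finset.sum_comm (s := Finset.Icc (k + 1) k0),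
    Finset.sum_comm (s := Finset.Icc (k0 + 1) n), Finset.sum_comm (s := Finset.Icc (k0 + 1) n),
    Finset.sum_comm (s := Finset.Icc (k + 1) k0)]
  simp only [Finset.mul_sum (s := (Finset.univ : Finset (Fin p)))]
  simp only [← Finset.sum_add_distrib (s := (Finset.univ : Finset (Fin p))),
    ← Finset.sum_sub_distrib (s := (Finset.univ : Finset (Fin p)))]
  refine Finset.sum_congr rfl fun l _ => ?_
  have hlow : ∀ i, i ≤ k0 → X i l = Z i l := fun i hi => by rw [hX, if_pos hi]
  have hhigh : ∀ i, k0 < i → X i l = Z i l + δ l := fun i hi => by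
    rw [hX, if_neg (by omega)]; rfl
  simp only [icc_split _ 1 k k0 (by omega) hkk0, icc_split _ (k + 1) k0 n (by omega) (by omega)]
  have e1 : ∑ i ∈ Finset.Icc 1 k, X i l = ∑ i ∈ Finset.Icc 1 k, Z i l :=
    Finset.sum_congr rfl fun i hi => hlow i (by simp at hi; omega)
  have e2 : ∑ i ∈ Finset.Icc (k + 1) k0, X i l = ∑ i ∈ Finset.Icc (k + 1) k0, Z i l :=
    Finset.sum_congr rfl fun i hi => hlow i (by simp at hi; omega)
  have e3 : ∑ i ∈ Finset.Icc (k0 + 1) n, X i l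
      = ∑ i ∈ Finset.Icc (k0 + 1) n, Z i l + ((n : ℝ) - k0) * δ l := by
    rw [Finset.sum_congr rfl fun i hi => hhigh i (by simp at hi; omega),
      Finset.sum_add_distrib, Finset.sum_const, nsmul_eq_mul, Nat.card_Icc]
    rw [show n + 1 - (k0 + 1) = n - k0 by omega, Nat.cast_sub (by omega)]
  rw [e1, e2, e3]
  have q1 : ∑ i ∈ Finset.Icc 1 k, X i l * X i l = ∑ i ∈ Finset.Icc 1 k, Z i l * Z i l :=
    Finset.sum_congr rfl fun i hi => by rw [hlow i (by simp at hi; omega)]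
  have q2 : ∑ i ∈ Finset.Icc (k + 1) k0, X i l * X i l
      = ∑ i ∈ Finset.Icc (k + 1) k0, Z i l * Z i l :=
    Finset.sum_congr rfl fun i hi => by rw [hlow i (by simp at hi; omega)]
  rw [q1, q2]
  simp only [← Finset.mul_sum]
  generalize ∑ i ∈ Finset.Icc (k0 + 1) n, X i l * X i l = xc
  generalize ∑ i ∈ Finset.Icc (k0 + 1) n, Z i l * Z i l = zc
  generalize ∑ i ∈ Finset.Icc (k + 1) k0, Z i l * Z i l = zb
  generalize ∑ i ∈ Finset.Icc 1 k, Z i l * Z i l = za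
  generalize ∑ i ∈ Finset.Icc (k0 + 1) n, Z i l = C
  generalize ∑ i ∈ Finset.Icc (k + 1) k0, Z i l = B
  generalize ∑ i ∈ Finset.Icc 1 k, Z i l = A
  field_simp
  ring
end
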